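/- arXiv:1905.05082 — 5 statements merged into one kernel-verified Lean document; each statement's English description precedes it below -/
import Mathlib

section
/- For every n ≥ 1 and every s, z ∈ (Fin n → ZMod 2), the normalized character sum (1/2^n) · ∑_{x : Fin n → ZMod 2} (-1)^{(s·x + x·z).val} (computed in ℝ) equals 1 if z = s and 0 otherwise. Consequently, the final state of the Bernstein–Vazirani quantum algorithm, whose amplitude at z is this sum, is exactly the basis state labeled by the secret string s. -/
theorem ZMod.neg_one_pow_val_add {R : Type*} [Ring R] (a b : ZMod 2) :
    (-1 : R) ^ (a + b).val = (-1) ^ a.val * (-1) ^ b.val := by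
  rw [ZMod.val_add, ← neg_one_pow_eq_pow_mod_two, pow_add]

theorem ZMod.neg_one_pow_val_sum {R ι : Type*} [CommRing R] (t : Finset ι) (f : ι → ZMod 2) :
    (-1 : R) ^ (∑ i ∈ t, f i).val = ∏ i ∈ t, (-1) ^ (f i).val := by
  classical
  induction t using Finset.induction_on with
  | empty => simp
  | insert a t ha ih =>
    rw [Finset.sum_insert ha, Finset.prod_insert ha, ZMod.neg_one_pow_val_add, ih]

theorem ZMod.sum_neg_one_pow_val_mul {R : Type*} [Ring R] (s z : ZMod 2) :
    ∑ a : ZMod 2, (-1 : R) ^ (s * a + a * z).val = if z = s then 2 else 0 := by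
  have h : (Finset.univ : Finset (ZMod 2)) = {0, 1} := rfl
  rw [h, Finset.sum_pair zero_ne_one]
  have val_one : (1 : ZMod 2).val = 1 := rfl
  have one_add_one : (1 + 1 : ZMod 2) = 0 := rfl
  obtain rfl | rfl : s = 0 ∨ s = 1 := by simpa [h] using Finset.mem_univ s
  all_goals obtain rfl | rfl : z = 0 ∨ z = 1 := by simpa [h] using Finset.mem_univ z
  all_goals simp [val_one, one_add_one, one_add_one_eq_two]

/-- Bernstein–Vazirani: the normalized character sum equals the Kronecker delta at the
secret string `s`, so the final state of the algorithm is exactly the basis state `|s⟩`. -/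
theorem bernstein_vazirani_amplitude (n : ℕ) (hn : 1 ≤ n) (s z : Fin n → ZMod 2) :
    (1 / 2 ^ n : ℝ) *
        ∑ x : Fin n → ZMod 2,
          (-1 : ℝ) ^ (((∑ i, s i * x i) + ∑ i, x i * z i : ZMod 2)).val =
      if z = s then 1 else 0 := by
  simp_rw [← Finset.sum_add_distrib, ZMod.neg_one_pow_val_sum]
  rw [← Fintype.piFinset_univ,
    ← Finset.prod_univ_sum (fun _ => Finset.univ)
      (fun i a => (-1 : ℝ) ^ (s i * a + a * z i).val)]
  simp_rw [ZMod.sum_neg_one_pow_val_mul]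
  split_ifs with h
  · simp [h]
  · obtain ⟨i, hi⟩ := Function.ne_iff.mp h
    rw [Finset.prod_eq_zero (Finset.mem_univ i) (if_neg hi), mul_zero]
end

section
/- Let n ≥ 1 and f : (Fin n → ZMod 2) → ZMod 2. If f is constant, then the integer sum ∑_{x} (-1)^{(f x).val} has absolute value 2^n, so the Deutsch–Jozsa acceptance probability |(1/2^n) ∑_x (-1)^{f(x)}|² equals 1. If f is balanced, i.e. the set {x : f x = 1} has exactly 2^{n-1} elements, then ∑_{x} (-1)^{(f x).val} = 0, so the acceptance probability equals 0. Hence one evaluation of the corresponding quantum oracle decides constant versus balanced with certainty. -/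
theorem ZMod.neg_one_pow_val_eq_one_sub_ite {R : Type*} [Ring R] (a : ZMod 2) :
    (-1 : R) ^ a.val = 1 - 2 * if a = 1 then 1 else 0 := by
  obtain rfl | rfl : a = 0 ∨ a = 1 := by revert a; decide
  · simp
  · rw [ZMod.val_one, if_pos rfl]
    norm_num

theorem ZMod.sum_neg_one_pow_val {R ι : Type*} [Ring R] [Fintype ι] (f : ι → ZMod 2) :
    ∑ x, (-1 : R) ^ (f x).val =
      Fintype.card ι - 2 * ((Finset.univ.filter fun x => f x = 1).card : R) := by
  simp only [ZMod.neg_one_pow_val_eq_one_sub_ite, Finset.sum_sub_distrib, ← Finset.mul_sum,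
    Finset.sum_boole]
  simp

/-- Deutsch–Jozsa: for a constant function the signed sum has absolute value `2^n`
(acceptance probability 1); for a balanced function the signed sum vanishes
(acceptance probability 0). -/
theorem deutsch_jozsa_acceptance (n : ℕ) (hn : 1 ≤ n)
    (f : (Fin n → ZMod 2) → ZMod 2) :
    ((∃ c, ∀ x, f x = c) →
        |∑ x : Fin n → ZMod 2, (-1 : ℤ) ^ (f x).val| = 2 ^ n ∧
          ((1 / 2 ^ n : ℝ) * ∑ x : Fin n → ZMod 2, (-1 : ℝ) ^ (f x).val) ^ 2 = 1) ∧
      ((Finset.univ.filter fun x : Fin n → ZMod 2 => f x = 1).card = 2 ^ (n - 1) →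
        (∑ x : Fin n → ZMod 2, (-1 : ℤ) ^ (f x).val) = 0 ∧
          ((1 / 2 ^ n : ℝ) * ∑ x : Fin n → ZMod 2, (-1 : ℝ) ^ (f x).val) ^ 2 = 0) := by
  refine ⟨?_, fun h => ?_⟩
  · rintro ⟨c, hc⟩
    have hsq : ((-1 : ℝ) ^ c.val) ^ 2 = 1 := by rw [pow_right_comm]; simp
    refine ⟨?_, ?_⟩
    · simp [hc, abs_mul, abs_pow]
    · simp [hc, hsq]
  · have hsum (R : Type) [Ring R] :
        ∑ x : Fin n → ZMod 2, (-1 : R) ^ (f x).val = 0 := by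
      rw [ZMod.sum_neg_one_pow_val, h]
      obtain ⟨m, rfl⟩ := Nat.exists_eq_add_of_le' hn
      simp [pow_succ']
    exact ⟨hsum ℤ, by simp [hsum ℝ]⟩
end

section
/- No-cloning in Quantum Simulation Logic (counting condition): let Ω be a type with exactly 4 elements (the ontic states of one elementary QSL system) and let T, W ⊆ Ω be the supports of two pure states, so |T| = |W| = 2. Then the reversibility condition 2·|T ∩ W| = |T ∩ W|² holds if and only if T ∩ W = ∅ or T = W. Hence a cloning transformation T × A ↦ T × T, W × A ↦ W × W (with A the support of a fixed pure auxiliary state) can only be reversible when the two states are disjoint (orthogonal) or identical (parallel), so no single QSL transformation clones an arbitrary state. -/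
/-- No-cloning in QSL: for supports `T`, `W` of two pure states on the 4-point ontic
state space, the reversibility counting condition `2|T ∩ W| = |T ∩ W|²` holds iff the
two states are disjoint (orthogonal) or identical (parallel). -/
theorem qsl_no_cloning (Ω : Type*) [Fintype Ω] [DecidableEq Ω]
    (hΩ : Fintype.card Ω = 4) (T W : Finset Ω)
    (hT : T.card = 2) (hW : W.card = 2) :
    2 * (T ∩ W).card = (T ∩ W).card ^ 2 ↔ T ∩ W = ∅ ∨ T = W := by
  constructor
  · intro h
    rcases Nat.eq_zero_or_pos (T ∩ W).card with h0 | hpos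
    · exact Or.inl (Finset.card_eq_zero.mp h0)
    · right
      have h2 : (T ∩ W).card = 2 := by nlinarith
      have hTI : T ∩ W = T := Finset.eq_of_subset_of_card_le Finset.inter_subset_left (by omega)
      have hWI : T ∩ W = W := Finset.eq_of_subset_of_card_le Finset.inter_subset_right (by omega)
      exact hTI.symm.trans hWI
  · rintro (h | rfl)
    · simp [h]
    · simp [hT]
end

section
/- Counting theorem for the QSL Grover subroutine (core of the O(2^n/n) theorem): let n ≥ 2 and x* ∈ (Fin n → ZMod 2). For r ∈ (Fin n → ZMod 2) define f̃_k(r) = ∏_{j ≠ k} (r j + x* j + 1) ∈ ZMod 2 and the subroutine output y(r) ∈ (Fin n → ZMod 2) by y(r) i = r i + ∏_{k ≠ i} (1 + f̃_k(r)). Then y(r) = x* if and only if r = x*, or r differs from x* in exactly one bit, or r is the bitwise complement of x*; consequently the set {r : y(r) = x*} has exactly n + 2 elements, so a uniformly random r yields x* with probability (n+2)/2^n. -/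
theorem ZMod.two_add_add_one_eq_zero_iff (a b : ZMod 2) : a + b + 1 = 0 ↔ a ≠ b := by
  revert a b; decide

theorem ZMod.two_one_add_eq_zero_iff (a : ZMod 2) : 1 + a = 0 ↔ a ≠ 0 := by
  revert a; decide

theorem ZMod.two_add_eq_iff (a b p : ZMod 2) : a + p = b ↔ (a ≠ b ↔ p ≠ 0) := by
  revert a b p; decide

theorem ZMod.two_ne_iff_eq_add_one (a b : ZMod 2) : a ≠ b ↔ a = b + 1 := by
  revert a b; decide

/-- The output bit `i` is correct iff membership of `i` in the support of `r - xstar` is equivalent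
to that support containing, for each `k ≠ i`, an index other than `k`. -/
theorem grover_output_bit_eq_iff {ι : Type*} [Fintype ι] [DecidableEq ι] (r xstar : ι → ZMod 2)
    (i : ι) :
    r i + ∏ k ∈ Finset.univ.erase i,
        (1 + ∏ j ∈ Finset.univ.erase k, (r j + xstar j + 1)) = xstar i ↔
      (r i ≠ xstar i ↔ ∀ k, k ≠ i → ∃ j, j ≠ k ∧ r j ≠ xstar j) := by
  rw [ZMod.two_add_eq_iff, Finset.prod_ne_zero_iff]
  simp only [Finset.mem_erase, Finset.mem_univ, and_true, ne_eq, ZMod.two_one_add_eq_zero_iff,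
    not_not, Finset.prod_eq_zero_iff, ZMod.two_add_add_one_eq_zero_iff]

theorem Finset.forall_mem_iff_exists_ne_mem_iff {ι : Type*} [Fintype ι] [DecidableEq ι]
    [Nontrivial ι] (S : Finset ι) :
    (∀ i, i ∈ S ↔ ∀ k, k ≠ i → ∃ j, j ≠ k ∧ j ∈ S) ↔
      S = ∅ ∨ S.card = 1 ∨ S = Finset.univ := by
  constructor
  · intro h
    rcases S.eq_empty_or_nonempty with hS | hS
    · exact Or.inl hS
    rcases Nat.lt_or_ge 1 S.card with hc | hc
    · refine Or.inr (Or.inr (Finset.eq_univ_of_forall fun i => (h i).2 fun k _ => ?_))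
      obtain ⟨j, hj, hjk⟩ := Finset.exists_mem_ne hc k
      exact ⟨j, hjk, hj⟩
    · exact Or.inr (Or.inl (le_antisymm hc hS.card_pos))
  · rintro (rfl | hc | rfl) i
    · obtain ⟨k, hk⟩ := exists_ne i
      simpa using ⟨k, hk⟩
    · obtain ⟨m, rfl⟩ := Finset.card_eq_one.1 hc
      simp only [Finset.mem_singleton]
      constructor
      · rintro rfl k hk
        exact ⟨i, hk.symm, rfl⟩
      · intro h
        by_contra hi
        obtain ⟨j, hj, hjm⟩ := h m (Ne.symm hi)
        exact hj hjm
    · simpa using fun k _ => exists_ne k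

theorem Finset.card_filter_eq_empty_or_card_eq_one_or_eq_univ {ι : Type*} [Fintype ι]
    [DecidableEq ι] [Nontrivial ι] :
    (Finset.univ.filter fun S : Finset ι => S = ∅ ∨ S.card = 1 ∨ S = Finset.univ).card =
      Fintype.card ι + 2 := by
  have hcard : 1 < Fintype.card ι := Fintype.one_lt_card
  have h : (Finset.univ.filter fun S : Finset ι => S = ∅ ∨ S.card = 1 ∨ S = Finset.univ) =
      insert ∅ (insert Finset.univ (Finset.powersetCard 1 Finset.univ)) := by
    ext S
    simp only [Finset.mem_filter, Finset.mem_univ, true_and, Finset.mem_insert,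
      Finset.mem_powersetCard, Finset.subset_univ]
    tauto
  rw [h, Finset.card_insert_of_notMem, Finset.card_insert_of_notMem, Finset.card_powersetCard]
  · simp
  · simp [Finset.mem_powersetCard, Finset.card_univ, hcard.ne']
  · simp [Finset.mem_powersetCard, Finset.univ_nonempty.ne_empty.symm]

/-- Counting theorem for the QSL Grover subroutine: the output `y(r)` equals the unique
satisfying assignment `x*` iff `r = x*`, or `r` differs from `x*` in exactly one bit, or
`r` is the bitwise complement of `x*`; hence exactly `n + 2` seeds `r` succeed. -/
theorem qsl_grover_counting (n : ℕ) (hn : 2 ≤ n) (xstar : Fin n → ZMod 2) :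
    let ftilde : (Fin n → ZMod 2) → Fin n → ZMod 2 :=
      fun r k => ∏ j ∈ Finset.univ.erase k, (r j + xstar j + 1)
    let y : (Fin n → ZMod 2) → Fin n → ZMod 2 :=
      fun r i => r i + ∏ k ∈ Finset.univ.erase i, (1 + ftilde r k)
    (∀ r : Fin n → ZMod 2, y r = xstar ↔
        (r = xstar ∨ (Finset.univ.filter fun i => r i ≠ xstar i).card = 1 ∨
          r = fun i => xstar i + 1)) ∧
      (Finset.univ.filter fun r : Fin n → ZMod 2 => y r = xstar).card = n + 2 := by
  intro ftilde y
  have : Nontrivial (Fin n) := Fin.nontrivial_iff_two_le.2 hn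
  have hy : ∀ r, y r = xstar ↔
      ((Finset.univ.filter fun i => r i ≠ xstar i) = ∅ ∨
        (Finset.univ.filter fun i => r i ≠ xstar i).card = 1 ∨
        (Finset.univ.filter fun i => r i ≠ xstar i) = Finset.univ) := by
    intro r
    rw [← Finset.forall_mem_iff_exists_ne_mem_iff, funext_iff]
    refine forall_congr' fun i => (grover_output_bit_eq_iff r xstar i).trans ?_
    simp only [Finset.mem_filter, Finset.mem_univ, true_and]
  refine ⟨fun r => (hy r).trans (or_congr ?_ (or_congr Iff.rfl ?_)), ?_⟩
  · simp [Finset.filter_eq_empty_iff, funext_iff]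
  · simp [ZMod.two_ne_iff_eq_add_one, funext_iff, -ne_eq]
  · have hcount :=
      Finset.card_filter_eq_empty_or_card_eq_one_or_eq_univ (ι := Fin n)
    rw [Fintype.card_fin] at hcount
    rw [← hcount]
    refine Finset.card_nbij' (fun r => Finset.univ.filter fun i => r i ≠ xstar i)
      (fun S i => if i ∈ S then xstar i + 1 else xstar i) ?_ ?_ ?_ ?_
    · intro r hr
      simpa using (hy r).1 (by simpa using hr)
    · intro S hS
      have hsupp : (Finset.univ.filter fun i =>
          (if i ∈ S then xstar i + 1 else xstar i) ≠ xstar i) = S := by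
        ext i
        simp
      simp only [Finset.mem_coe, Finset.mem_filter, Finset.mem_univ, true_and] at hS ⊢
      rw [hy, hsupp]
      exact hS
    · intro r _
      ext i
      by_cases h : r i = xstar i
      · simp [h]
      · simp [h, ← (ZMod.two_ne_iff_eq_add_one _ _).1 h]
    · intro S _
      ext i
      simp
end

section
/- Deterministic Simon output lies in, and spans, the orthogonal complement: let n ≥ 1, let U : (Fin n → ZMod 2) ≃ₗ[ZMod 2] (Fin n → ZMod 2) be a linear bijection preserving the dot product (U x · U y = x · y for all x, y), let s ≠ 0, and let v ∈ (Fin n → ZMod 2) satisfy s·v = 1 and v·v = 1. Define L(p) = U⁻¹(p) + (s · U⁻¹(p)) • v. Then (i) s · L(p) = 0 for every p, and (ii) for every w with s·w = 0 there exists p with L(p) = w; that is, the image of the linear map L is exactly the subspace {w : s·w = 0}. Hence letting p range over a basis of (Fin n → ZMod 2), the n outputs L(p) span the (n−1)-dimensional subspace orthogonal to s, which yields a deterministic (zero-error, linear-query) algorithm for Simon's problem both quantumly and in QSL. -/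
/-- Deterministic Simon output: for a dot-product-preserving linear bijection `U`, a
nonzero mask `s`, and `v` with `s·v = 1`, `v·v = 1`, the output
`L(p) = U⁻¹(p) + (s·U⁻¹(p)) • v` is always orthogonal to `s`, and every string orthogonal
to `s` arises as some `L(p)`. -/
theorem deterministic_simon (n : ℕ) (hn : 1 ≤ n)
    (U : (Fin n → ZMod 2) ≃ₗ[ZMod 2] (Fin n → ZMod 2))
    (hU : ∀ x y : Fin n → ZMod 2, ∑ i, U x i * U y i = ∑ i, x i * y i)
    (s : Fin n → ZMod 2) (hs : s ≠ 0) (v : Fin n → ZMod 2)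
    (hsv : ∑ i, s i * v i = 1) (hvv : ∑ i, v i * v i = 1) :
    (∀ p : Fin n → ZMod 2,
        ∑ i, s i * (U.symm p + (∑ j, s j * U.symm p j) • v) i = 0) ∧
      ∀ w : Fin n → ZMod 2, (∑ i, s i * w i) = 0 →
        ∃ p : Fin n → ZMod 2, U.symm p + (∑ j, s j * U.symm p j) • v = w := by
  refine ⟨fun p => ?_, fun w hw => ⟨U w, by simp [hw]⟩⟩
  change s ⬝ᵥ v = 1 at hsv
  change s ⬝ᵥ (U.symm p + (s ⬝ᵥ U.symm p) • v) = 0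
  rw [dotProduct_add, dotProduct_smul, hsv, smul_eq_mul, mul_one, CharTwo.add_self_eq_zero]
end
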